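/- For Schwartz functions (or L^∞ functions) f, g on ℝ² whose Fourier transforms are supported in the dyadic annuli {2^{j-1} ≤ |ξ| ≤ 2^{j+1}} and {2^{j'-1} ≤ |ξ| ≤ 2^{j'+1}} respectively with |j - j'| ≤ 1, the bilinear Fourier multiplier with symbol m(ξ,η) = (ξ, -η)/(|ξ|+|η|) on ℝ²×ℝ² satisfies ‖F⁻¹_{ℝ⁴}[m(ξ,η) f̂(ξ) ĝ(η)]‖_{L^∞(ℝ⁴)} ≤ C ‖f‖_{L^∞(ℝ²)} ‖g‖_{L^∞(ℝ²)} where the constant C is independent of j and j'. -/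

import Mathlib

open MeasureTheory Real
open scoped ENNReal FourierTransform

noncomputable section

abbrev E2 := EuclideanSpace ℝ (Fin 2)

def conv (f g : E2 → ℂ) : E2 → ℂ :=
  MeasureTheory.convolution f g (ContinuousLinearMap.mul ℂ ℂ) volume

def lqNorm (q : ℝ≥0∞) (a : ℤ → ℝ≥0∞) : ℝ≥0∞ :=
  if q = ∞ then ⨆ j, a j else (∑' j, (a j) ^ q.toReal) ^ (1 / q.toReal)

def besovNorm (φ : ℤ → E2 → ℂ) (s : ℝ) (p q : ℝ≥0∞) (f : E2 → ℂ) : ℝ≥0∞ :=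
  lqNorm q (fun j => (2 : ℝ≥0∞) ^ (s * (j : ℝ)) * eLpNorm (conv (φ j) f) p volume)

def IsLPFamily (φ : ℤ → E2 → ℂ) : Prop :=
  (∀ j, Integrable (φ j)) ∧
  (∀ j, Integrable (𝓕 (φ j))) ∧
  (∀ j ξ, 𝓕 (φ j) ξ ≠ 0 → (2 : ℝ) ^ (j - 1) ≤ ‖ξ‖ ∧ ‖ξ‖ ≤ (2 : ℝ) ^ (j + 1)) ∧
  (∀ ξ : E2, ξ ≠ 0 → HasSum (fun j => 𝓕 (φ j) ξ) 1) ∧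
  (∀ j x, φ j x = (2 : ℝ) ^ (2 * j) • φ 0 ((2 : ℝ) ^ j • x))

open scoped RealInnerProductSpace

/-- The symbol m(ξ,η) = (ξ,−η)/(|ξ|+|η|) ∈ ℝ⁴ (zero at the origin). -/
def m4 (ξ η : E2) : Fin 4 → ℝ := fun k =>
  Fin.append (fun i => ξ i) (fun i => -η i) k / (‖ξ‖ + ‖η‖)

/-- Bilinear Fourier multiplier:  F⁻¹_{ℝ⁴}[m(ξ,η) f̂(ξ) ĝ(η)]. -/
def bilinMult (f g : E2 → ℂ) : E2 × E2 → Fin 4 → ℂ := fun p k =>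
  ∫ ξ : E2, ∫ η : E2, ((m4 ξ η k : ℝ) : ℂ) * 𝓕 f ξ * 𝓕 g η *
    Complex.exp (2 * π * Complex.I * ((⟪ξ, p.1⟫ + ⟪η, p.2⟫ : ℝ)))

section

open scoped ContDiff SchwartzMap

section FourierBound

variable {V : Type*} [NormedAddCommGroup V] [InnerProductSpace ℝ V] [FiniteDimensional ℝ V]
  [MeasurableSpace V] [BorelSpace V]

/-- Fourier transform of a modulated dilate. -/
theorem fourier_comp_smul_mul_char (M : V → ℂ) {c : ℝ} (hc : c ≠ 0) (z w : V) :
    𝓕 (fun ζ => M (c • ζ) * (𝐞 ⟪ζ, z⟫ : ℂ)) w =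
      |(c ^ Module.finrank ℝ V)⁻¹| • 𝓕 M (c⁻¹ • (w - z)) := by
  rw [Real.fourier_eq, Real.fourier_eq, ← Measure.integral_comp_smul volume _ c]
  congr 1 with ζ
  have hphase : -⟪c • ζ, c⁻¹ • (w - z)⟫ = -⟪ζ, w⟫ + ⟪ζ, z⟫ := by
    rw [real_inner_smul_left, real_inner_smul_right, inner_sub_right]
    field_simp
    ring
  rw [hphase, AddChar.map_add_eq_mul]
  simp only [Circle.smul_def, Circle.coe_mul, smul_eq_mul]
  ring

/-- Modulation and dilation preserve the `L¹` norm of the Fourier transform. -/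
theorem integral_norm_fourier_comp_smul_mul_char (M : V → ℂ) {c : ℝ} (hc : c ≠ 0) (z : V) :
    ∫ w, ‖𝓕 (fun ζ => M (c • ζ) * (𝐞 ⟪ζ, z⟫ : ℂ)) w‖ = ∫ w, ‖𝓕 M w‖ := by
  simp_rw [fourier_comp_smul_mul_char M hc, norm_smul]
  rw [integral_const_mul, integral_sub_right_eq_self (fun w => ‖𝓕 M (c⁻¹ • w)‖) z,
    Measure.integral_comp_inv_smul volume (fun w => ‖𝓕 M w‖) c, smul_eq_mul, ← mul_assoc]
  have : c ^ Module.finrank ℝ V ≠ 0 := pow_ne_zero _ hc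
  rw [norm_abs_eq_norm, Real.norm_eq_abs, ← abs_mul, inv_mul_cancel₀ this, abs_one, one_mul]

theorem norm_integral_fourier_mul_le (M : 𝓢(V, ℂ)) {F : V → ℂ} (hF : Integrable F) {A : ℝ}
    (hA : ∀ᵐ w, ‖F w‖ ≤ A) {c : ℝ} (hc : c ≠ 0) (z : V) :
    ‖∫ ζ, 𝓕 F ζ * (M (c • ζ) * (𝐞 ⟪ζ, z⟫ : ℂ))‖ ≤ A * ∫ w, ‖𝓕 (M : V → ℂ) w‖ := by
  set G : V → ℂ := fun ζ => M (c • ζ) * (𝐞 ⟪ζ, z⟫ : ℂ) with hGdef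
  have hMc : Integrable (fun ζ => M (c • ζ)) := M.integrable.comp_smul hc
  have hG : Integrable G := by
    refine hMc.mono (hMc.aestronglyMeasurable.mul ?_) (.of_forall fun ζ => by
      rw [norm_mul, Circle.norm_coe, mul_one])
    have : Continuous fun ζ : V => (𝐞 ⟪ζ, z⟫ : ℂ) := by fun_prop
    exact this.aestronglyMeasurable
  have hdual : ∫ ζ, 𝓕 F ζ * G ζ = ∫ w, F w * 𝓕 G w := by
    simpa using! VectorFourier.integral_fourierIntegral_smul_eq_flip (L := innerₗ V)
      Real.continuous_fourierChar continuous_inner hF hG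
  have hFG : Integrable (𝓕 G) := by
    have hM : Integrable (𝓕 (M : V → ℂ)) := (𝓕 M).integrable
    have := (((hM.comp_smul (inv_ne_zero hc)).comp_sub_right z)).smul
      |(c ^ Module.finrank ℝ V)⁻¹|
    refine this.congr (.of_forall fun w => ?_)
    rw [hGdef, fourier_comp_smul_mul_char _ hc]
    rfl
  calc ‖∫ ζ, 𝓕 F ζ * G ζ‖ = ‖∫ w, F w * 𝓕 G w‖ := by rw [hdual]
    _ ≤ ∫ w, A * ‖𝓕 G w‖ := by
      refine norm_integral_le_of_norm_le (hFG.norm.const_mul A) ?_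
      filter_upwards [hA] with w hw
      rw [norm_mul]
      gcongr
    _ = A * ∫ w, ‖𝓕 (M : V → ℂ) w‖ := by
      rw [integral_const_mul, integral_norm_fourier_comp_smul_mul_char _ hc]

end FourierBound

theorem integral_withLp_prod (F : E2 × E2 → ℂ) :
    ∫ w : WithLp 2 (E2 × E2), F w.ofLp = ∫ p : E2 × E2, F p :=
  (WithLp.volume_preserving_ofLp E2 E2).integral_comp
    (MeasurableEquiv.toLp 2 (E2 × E2)).symm.measurableEmbedding F

theorem fourier_tensor (f g : E2 → ℂ) (ζ : WithLp 2 (E2 × E2)) :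
    𝓕 (fun w : WithLp 2 (E2 × E2) => f w.fst * g w.snd) ζ = 𝓕 f ζ.fst * 𝓕 g ζ.snd := by
  rw [Real.fourier_eq, Real.fourier_eq, Real.fourier_eq, ← integral_prod_mul,
    ← Measure.volume_eq_prod, ← integral_withLp_prod]
  congr 1 with w
  rw [WithLp.prod_inner_apply, neg_add, AddChar.map_add_eq_mul]
  simp only [Circle.smul_def, Circle.coe_mul, smul_eq_mul, WithLp.ofLp_fst, WithLp.ofLp_snd]
  ring

theorem integrable_tensor {f g : E2 → ℂ} (hf : Integrable f) (hg : Integrable g) :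
    Integrable (fun w : WithLp 2 (E2 × E2) => f w.fst * g w.snd) :=
  (WithLp.volume_preserving_ofLp E2 E2).integrable_comp_of_integrable (hf.mul_prod hg)

theorem ae_norm_tensor_le {f g : E2 → ℂ} {A B : ℝ} (hf : ∀ᵐ x, ‖f x‖ ≤ A)
    (hg : ∀ᵐ x, ‖g x‖ ≤ B) (hA : 0 ≤ A) :
    ∀ᵐ w : WithLp 2 (E2 × E2), ‖f w.fst * g w.snd‖ ≤ A * B := by
  have h1 : ∀ᵐ p : E2 × E2, ‖f p.1‖ ≤ A := Measure.quasiMeasurePreserving_fst.ae hf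
  have h2 : ∀ᵐ p : E2 × E2, ‖g p.2‖ ≤ B := Measure.quasiMeasurePreserving_snd.ae hg
  refine (WithLp.volume_preserving_ofLp E2 E2).quasiMeasurePreserving.ae
    (p := fun p => ‖f p.1 * g p.2‖ ≤ A * B) ?_
  filter_upwards [h1, h2] with p h1 h2
  rw [norm_mul]
  gcongr

theorem m4_smul {c : ℝ} (hc : 0 < c) (ξ η : E2) (k : Fin 4) :
    m4 (c • ξ) (c • η) k = m4 ξ η k := by
  have h : Fin.append (fun i => (c • ξ) i) (fun i => -(c • η) i) k =
      c * Fin.append (fun i => ξ i) (fun i => -η i) k := by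
    refine Fin.addCases (m := 2) (n := 2) (fun i => ?_) (fun i => ?_) k
    · simp only [Fin.append_left]; simp
    · simp only [Fin.append_right]; simp
  rw [m4, m4, h, norm_smul, norm_smul, Real.norm_of_nonneg hc.le, ← mul_add,
    mul_div_mul_left _ _ hc.ne']

theorem norm_m4_le (ξ η : E2) (k : Fin 4) : ‖m4 ξ η k‖ ≤ 1 := by
  have h : ‖Fin.append (fun i => ξ i) (fun i => -η i) k‖ ≤ ‖ξ‖ + ‖η‖ := by
    refine Fin.addCases (m := 2) (n := 2) (fun i => ?_) (fun i => ?_) k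
    · rw [Fin.append_left]
      exact (PiLp.norm_apply_le ξ i).trans (le_add_of_nonneg_right (norm_nonneg _))
    · rw [Fin.append_right, norm_neg]
      exact (PiLp.norm_apply_le η i).trans (le_add_of_nonneg_left (norm_nonneg _))
  rw [m4, norm_div, Real.norm_of_nonneg (by positivity : 0 ≤ ‖ξ‖ + ‖η‖)]
  exact div_le_one_of_le₀ h (by positivity)

theorem contDiffAt_m4 (k : Fin 4) {ζ : WithLp 2 (E2 × E2)} (h1 : ζ.fst ≠ 0) (h2 : ζ.snd ≠ 0) :
    ContDiffAt ℝ ∞ (fun ζ : WithLp 2 (E2 × E2) => m4 ζ.fst ζ.snd k) ζ := by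
  have hfst : ContDiff ℝ ∞ (fun ζ : WithLp 2 (E2 × E2) => ζ.fst) :=
    (WithLp.fstL 2 ℝ E2 E2).contDiff
  have hsnd : ContDiff ℝ ∞ (fun ζ : WithLp 2 (E2 × E2) => ζ.snd) :=
    (WithLp.sndL 2 ℝ E2 E2).contDiff
  have hnum : ContDiff ℝ ∞ (fun ζ : WithLp 2 (E2 × E2) =>
      Fin.append (fun i => ζ.fst i) (fun i => -ζ.snd i) k) := by
    refine Fin.addCases (m := 2) (n := 2) (fun i => ?_) (fun i => ?_) k
    · simp only [Fin.append_left]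
      exact (EuclideanSpace.proj (𝕜 := ℝ) i).contDiff.comp hfst
    · simp only [Fin.append_right]
      exact ((EuclideanSpace.proj (𝕜 := ℝ) i).contDiff.comp hsnd).neg
  exact hnum.contDiffAt.div ((hfst.contDiffAt.norm ℝ h1).add (hsnd.contDiffAt.norm ℝ h2))
    (by positivity)

/-- The symbol agrees with a Schwartz function where both frequencies have size about one. -/
theorem exists_schwartz_eq_m4 (k : Fin 4) : ∃ M : 𝓢(WithLp 2 (E2 × E2), ℂ),
    ∀ ξ η : E2, ‖ξ‖ ∈ Set.Icc (1 / 4 : ℝ) 4 → ‖η‖ ∈ Set.Icc (1 / 4 : ℝ) 4 →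
      M (WithLp.toLp 2 (ξ, η)) = (m4 ξ η k : ℂ) := by
  let b : ContDiffBump (17 / 8 : ℝ) := ⟨15 / 8, 2, by norm_num, by norm_num⟩
  have hb0 : ∀ t, t < 1 / 8 → b t = 0 := fun t ht => b.zero_of_le_dist (by
    rw [Real.dist_eq, abs_of_neg (by linarith)]; change 2 ≤ _; linarith)
  have hb4 : ∀ t, 5 < t → b t = 0 := fun t ht => b.zero_of_le_dist (by
    rw [Real.dist_eq, abs_of_pos (by linarith)]; change 2 ≤ _; linarith)
  have hb1 : ∀ t ∈ Set.Icc (1 / 4 : ℝ) 4, b t = 1 := fun t ht => b.one_of_mem_closedBall (by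
    rw [Metric.mem_closedBall, Real.dist_eq, abs_le]
    change -(15 / 8 : ℝ) ≤ _ ∧ _ ≤ (15 / 8 : ℝ)
    constructor <;> linarith [ht.1, ht.2])
  let P : WithLp 2 (E2 × E2) → ℝ := fun ζ => b ‖ζ.fst‖ * b ‖ζ.snd‖ * m4 ζ.fst ζ.snd k
  have hfst : ContDiff ℝ ∞ (fun ζ : WithLp 2 (E2 × E2) => ζ.fst) :=
    (WithLp.fstL 2 ℝ E2 E2).contDiff
  have hsnd : ContDiff ℝ ∞ (fun ζ : WithLp 2 (E2 × E2) => ζ.snd) :=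
    (WithLp.sndL 2 ℝ E2 E2).contDiff
  have hP : ContDiff ℝ ∞ P := by
    rw [contDiff_iff_contDiffAt]
    intro ζ
    by_cases h1 : ζ.fst = 0
    · refine contDiffAt_const (c := (0 : ℝ)) |>.congr_of_eventuallyEq ?_
      have : ∀ᶠ w : WithLp 2 (E2 × E2) in nhds ζ, ‖w.fst‖ < 1 / 8 :=
        hfst.continuous.norm.continuousAt.eventually_lt continuousAt_const (by simp [h1])
      filter_upwards [this] with w hw
      simp [P, hb0 _ hw]
    by_cases h2 : ζ.snd = 0
    · refine contDiffAt_const (c := (0 : ℝ)) |>.congr_of_eventuallyEq ?_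
      have : ∀ᶠ w : WithLp 2 (E2 × E2) in nhds ζ, ‖w.snd‖ < 1 / 8 :=
        hsnd.continuous.norm.continuousAt.eventually_lt continuousAt_const (by simp [h2])
      filter_upwards [this] with w hw
      simp [P, hb0 _ hw]
    exact ((b.contDiff.contDiffAt.comp ζ (hfst.contDiffAt.norm ℝ h1)).mul
      (b.contDiff.contDiffAt.comp ζ (hsnd.contDiffAt.norm ℝ h2))).mul (contDiffAt_m4 k h1 h2)
  have hsupp : HasCompactSupport P := by
    refine HasCompactSupport.of_support_subset_isCompact
      (isCompact_closedBall (0 : WithLp 2 (E2 × E2)) 10) fun ζ hζ => ?_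
    have h1 : ‖ζ.fst‖ ≤ 5 := by
      by_contra! h
      exact hζ (by simp [P, hb4 _ h])
    have h2 : ‖ζ.snd‖ ≤ 5 := by
      by_contra! h
      exact hζ (by simp [P, hb4 _ h])
    rw [mem_closedBall_zero_iff, WithLp.prod_norm_eq_of_L2, Real.sqrt_le_left (by norm_num)]
    nlinarith [norm_nonneg ζ.fst, norm_nonneg ζ.snd]
  refine ⟨(hsupp.comp_left Complex.ofReal_zero).toSchwartzMap
    (Complex.ofRealCLM.contDiff.comp hP), fun ξ η hξ hη => ?_⟩
  change ((b ‖ξ‖ * b ‖η‖ * m4 ξ η k : ℝ) : ℂ) = _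
  rw [hb1 _ hξ, hb1 _ hη, one_mul, one_mul]

theorem integral_integral_eq_withLp {F : E2 → E2 → ℂ}
    (hF : Integrable (Function.uncurry F)) :
    ∫ ξ, ∫ η, F ξ η = ∫ ζ : WithLp 2 (E2 × E2), F ζ.fst ζ.snd := by
  rw [integral_integral hF, ← Measure.volume_eq_prod, ← integral_withLp_prod]
  rfl

theorem measurable_m4 (k : Fin 4) : Measurable fun p : E2 × E2 => m4 p.1 p.2 k := by
  refine Measurable.div ?_ (by fun_prop)
  refine Fin.addCases (m := 2) (n := 2) (fun i => ?_) (fun i => ?_) k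
  · simp only [Fin.append_left]; fun_prop
  · simp only [Fin.append_right]; fun_prop

theorem bilinMult_apply_eq {f g : E2 → ℂ} (hf : Integrable (𝓕 f)) (hg : Integrable (𝓕 g))
    (p : E2 × E2) (k : Fin 4) :
    bilinMult f g p k = ∫ ζ : WithLp 2 (E2 × E2), 𝓕 f ζ.fst * 𝓕 g ζ.snd *
      ((m4 ζ.fst ζ.snd k : ℂ) * (𝐞 ⟪ζ, WithLp.toLp 2 p⟫ : ℂ)) := by
  rw [bilinMult, integral_integral_eq_withLp]
  · congr 1 with ζ
    rw [WithLp.prod_inner_apply, Real.fourierChar_apply]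
    simp only [WithLp.ofLp_fst, WithLp.ofLp_snd]
    push_cast
    ring_nf
  · have hfg := hf.mul_prod hg
    refine hfg.mono ?_ (.of_forall fun q => ?_)
    · have hm : AEStronglyMeasurable (fun q : E2 × E2 => ((m4 q.1 q.2 k : ℝ) : ℂ)) :=
        (Complex.measurable_ofReal.comp (measurable_m4 k)).aestronglyMeasurable
      have he : Continuous fun q : E2 × E2 =>
        Complex.exp (2 * π * Complex.I * ((⟪q.1, p.1⟫ + ⟪q.2, p.2⟫ : ℝ))) := by fun_prop
      refine ((hm.mul hfg.aestronglyMeasurable).mul he.aestronglyMeasurable).congr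
        (.of_forall fun q => ?_)
      simp only [Pi.mul_apply, Function.uncurry, mul_assoc]
    · have he : ‖Complex.exp (2 * π * Complex.I * ((⟪q.1, p.1⟫ + ⟪q.2, p.2⟫ : ℝ)))‖ = 1 := by
        rw [Complex.norm_exp]; simp
      simp only [Function.uncurry, norm_mul, he, mul_one, Complex.norm_real]
      rw [mul_assoc]
      exact mul_le_of_le_one_left (by positivity) (norm_m4_le _ _ k)

theorem fourier_eq_mul_of_conv_eq {φ f : E2 → ℂ} (hφ : Integrable φ) (hf : Integrable f)
    (h : ∀ x, conv φ f x = f x) (ξ : E2) : 𝓕 f ξ = 𝓕 φ ξ * 𝓕 f ξ := by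
  conv_lhs => rw [← funext h]
  exact Real.fourier_mul_convolution_eq hφ hf ξ

theorem norm_smul_mem_Icc_of_mem_annulus {i j : ℤ} (hij : |j - i| ≤ 1) {ξ : E2}
    (h : (2 : ℝ) ^ (i - 1) ≤ ‖ξ‖ ∧ ‖ξ‖ ≤ (2 : ℝ) ^ (i + 1)) :
    ‖(2 : ℝ) ^ (-j) • ξ‖ ∈ Set.Icc (1 / 4 : ℝ) 4 := by
  rw [abs_le] at hij
  have h2 : (0 : ℝ) < 2 ^ (-j) := by positivity
  rw [norm_smul, Real.norm_of_nonneg h2.le]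
  constructor
  · calc (1 / 4 : ℝ) = 2 ^ (-2 : ℤ) := by norm_num
      _ ≤ 2 ^ (-j + (i - 1)) := zpow_le_zpow_right₀ one_le_two (by omega)
      _ = 2 ^ (-j) * 2 ^ (i - 1) := zpow_add₀ two_ne_zero _ _
      _ ≤ _ := by gcongr; exact h.1
  · calc (2 : ℝ) ^ (-j) * ‖ξ‖ ≤ 2 ^ (-j) * 2 ^ (i + 1) := by gcongr; exact h.2
      _ = 2 ^ (-j + (i + 1)) := (zpow_add₀ two_ne_zero _ _).symm
      _ ≤ 2 ^ (2 : ℤ) := zpow_le_zpow_right₀ one_le_two (by omega)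
      _ = 4 := by norm_num

theorem fourier_eq_zero_of_not_integrable {f : E2 → ℂ} (hf : ¬ Integrable f) : 𝓕 f = 0 := by
  ext ξ
  rw [Real.fourier_eq]
  exact integral_undef fun h => hf ((Real.fourierIntegral_convergent_iff ξ).1 h)

theorem integrable_fourier_of_conv_eq {φ f : E2 → ℂ} (hφ : Integrable φ)
    (hφ' : Integrable (𝓕 φ)) (hf : Integrable f) (h : ∀ x, conv φ f x = f x) :
    Integrable (𝓕 f) := by
  have hc : Continuous (𝓕 f) := VectorFourier.fourierIntegral_continuous (L := innerₗ E2)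
    Real.continuous_fourierChar continuous_inner hf
  have := hφ'.mul_bdd (c := ∫ x, ‖f x‖) hc.aestronglyMeasurable
    (.of_forall fun ξ => VectorFourier.norm_fourierIntegral_le_integral_norm _ _ _ _ _)
  exact this.congr (.of_forall fun ξ => (fourier_eq_mul_of_conv_eq hφ hf h ξ).symm)

theorem norm_bilinMult_apply_le {φ : ℤ → E2 → ℂ} (hφ : IsLPFamily φ) {k : Fin 4}
    {M : 𝓢(WithLp 2 (E2 × E2), ℂ)}
    (hM : ∀ ξ η : E2, ‖ξ‖ ∈ Set.Icc (1 / 4 : ℝ) 4 → ‖η‖ ∈ Set.Icc (1 / 4 : ℝ) 4 →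
      M (WithLp.toLp 2 (ξ, η)) = (m4 ξ η k : ℂ))
    {j j' : ℤ} (hj : |j - j'| ≤ 1) {f g : E2 → ℂ}
    (hf : ∀ x, conv (φ j) f x = f x) (hg : ∀ x, conv (φ j') g x = g x) {A B : ℝ}
    (hA : 0 ≤ A) (hB : 0 ≤ B) (hfA : ∀ᵐ x, ‖f x‖ ≤ A) (hgB : ∀ᵐ x, ‖g x‖ ≤ B) (p : E2 × E2) :
    ‖bilinMult f g p k‖ ≤ A * B * ∫ w, ‖𝓕 (M : WithLp 2 (E2 × E2) → ℂ) w‖ := by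
  have hnonneg : 0 ≤ A * B * ∫ w, ‖𝓕 (M : WithLp 2 (E2 × E2) → ℂ) w‖ :=
    mul_nonneg (mul_nonneg hA hB) (integral_nonneg fun _ => norm_nonneg _)
  by_cases hfi : Integrable f
  swap
  · simpa [bilinMult, fourier_eq_zero_of_not_integrable hfi] using hnonneg
  by_cases hgi : Integrable g
  swap
  · simpa [bilinMult, fourier_eq_zero_of_not_integrable hgi] using hnonneg
  obtain ⟨hφi, hφi', hφs, -, -⟩ := hφ
  have hc : (0 : ℝ) < 2 ^ (-j) := by positivity
  have key : bilinMult f g p k = ∫ ζ : WithLp 2 (E2 × E2),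
      𝓕 (fun w : WithLp 2 (E2 × E2) => f w.fst * g w.snd) ζ *
        (M ((2 : ℝ) ^ (-j) • ζ) * (𝐞 ⟪ζ, WithLp.toLp 2 p⟫ : ℂ)) := by
    rw [bilinMult_apply_eq (integrable_fourier_of_conv_eq (hφi j) (hφi' j) hfi hf)
      (integrable_fourier_of_conv_eq (hφi j') (hφi' j') hgi hg)]
    congr 1 with ζ
    rw [fourier_tensor]
    by_cases h1 : 𝓕 f ζ.fst = 0
    · simp [h1]
    by_cases h2 : 𝓕 g ζ.snd = 0
    · simp [h2]
    have h1' := hφs j ζ.fst fun h => h1 (by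
      rw [fourier_eq_mul_of_conv_eq (hφi j) hfi hf, h, zero_mul])
    have h2' := hφs j' ζ.snd fun h => h2 (by
      rw [fourier_eq_mul_of_conv_eq (hφi j') hgi hg, h, zero_mul])
    have hMζ : M ((2 : ℝ) ^ (-j) • ζ) = (m4 ζ.fst ζ.snd k : ℂ) := by
      rw [← m4_smul hc ζ.fst ζ.snd k]
      exact hM _ _ (norm_smul_mem_Icc_of_mem_annulus (by simp) h1')
        (norm_smul_mem_Icc_of_mem_annulus hj h2')
    rw [hMζ]
  rw [key]
  exact norm_integral_fourier_mul_le M (integrable_tensor hfi hgi)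
    (ae_norm_tensor_le hfA hgB hA) hc.ne' _

end

/-- Bilinear multiplier bound on frequency-localized functions:
if f = φ_j * f, g = φ_{j'} * g with |j − j'| ≤ 1, then
‖F⁻¹_{ℝ⁴}[m(ξ,η) f̂ ĝ]‖_{L^∞(ℝ⁴)} ≤ C‖f‖_{L^∞}‖g‖_{L^∞}, C independent of j, j'. -/
theorem bilinear_multiplier_bound
    (φ : ℤ → E2 → ℂ) (hφ : IsLPFamily φ) :
    ∃ C > (0 : ℝ), ∀ (j j' : ℤ), |j - j'| ≤ 1 → ∀ f g : E2 → ℂ,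
      (∀ x, conv (φ j) f x = f x) → (∀ x, conv (φ j') g x = g x) →
      eLpNorm f ∞ volume ≠ ∞ → eLpNorm g ∞ volume ≠ ∞ →
      eLpNorm (bilinMult f g) ∞ volume ≤
        ENNReal.ofReal C * eLpNorm f ∞ volume * eLpNorm g ∞ volume := by
  choose M hM using exists_schwartz_eq_m4
  let I : Fin 4 → ℝ := fun k => ∫ w, ‖𝓕 (M k : WithLp 2 (E2 × E2) → ℂ) w‖
  have hI : ∀ k, 0 ≤ I k := fun k => integral_nonneg fun _ => norm_nonneg _
  have hIsum : ∀ k, I k ≤ 1 + ∑ i, I i := fun k =>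
    (Finset.single_le_sum (fun i _ => hI i) (Finset.mem_univ k)).trans (by linarith)
  have hC : 0 < 1 + ∑ i, I i := by linarith [Finset.sum_nonneg fun i (_ : i ∈ Finset.univ) => hI i]
  refine ⟨1 + ∑ i, I i, hC, fun j j' hj f g hf hg hfb hgb => ?_⟩
  have hess : ∀ {u : E2 → ℂ}, eLpNorm u ∞ volume ≠ ∞ →
      ∀ᵐ x, ‖u x‖ ≤ (eLpNorm u ∞ volume).toReal := fun {u} hu => by
    filter_upwards [enorm_ae_le_eLpNormEssSup u volume] with x hx
    rw [← toReal_enorm]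
    exact ENNReal.toReal_mono hu (by simpa using hx)
  rw [← ENNReal.ofReal_toReal hfb, ← ENNReal.ofReal_toReal hgb, ← ENNReal.ofReal_mul hC.le,
    ← ENNReal.ofReal_mul (by positivity), eLpNorm_exponent_top]
  refine eLpNormEssSup_le_of_ae_bound (.of_forall fun p => ?_)
  rw [pi_norm_le_iff_of_nonneg (by positivity)]
  intro k
  refine (norm_bilinMult_apply_le hφ (hM k) hj hf hg ENNReal.toReal_nonneg
    ENNReal.toReal_nonneg (hess hfb) (hess hgb) p).trans ?_
  rw [mul_assoc (1 + ∑ i, I i), mul_comm (1 + ∑ i, I i)]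
  exact mul_le_mul_of_nonneg_left (hIsum k) (by positivity)
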